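/- arXiv:1501.01328 — 3 statements merged into one kernel-verified Lean document; each statement's English description precedes it below -/
import Mathlib

section
/- Let χ be a functorially finite subcategory of A-mod closed under extensions and containing all projective modules. Then χ is finite (has only finitely many isomorphism classes of indecomposable modules) if and only if there is a bound on the Jordan–Hölder lengths of the indecomposable modules in χ. -/
open CategoryTheory Limits

universe u

section Base
variable {A : Type} [Ring A]

/-- An object of `ModuleCat A` is indecomposable. -/
def Indec (X : ModuleCat.{0} A) : Prop :=
  Nontrivial X ∧ ∀ e : X ⟶ X, e ≫ e = e → e = 0 ∨ e = 𝟙 X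

/-- `f` is irreducible with respect to the subcategory `χ`. -/
def IrredIn (χ : ModuleCat.{0} A → Prop) {X Y : ModuleCat.{0} A} (f : X ⟶ Y) : Prop :=
  ¬ IsSplitMono f ∧ ¬ IsSplitEpi f ∧
    ∀ (Z : ModuleCat.{0} A), χ Z → ∀ (h : X ⟶ Z) (g : Z ⟶ Y), f = h ≫ g →
      IsSplitMono h ∨ IsSplitEpi g

def RightAlmostSplitIn (χ : ModuleCat.{0} A → Prop) {X Y : ModuleCat.{0} A} (f : X ⟶ Y) : Prop :=
  ¬ IsSplitEpi f ∧ ∀ (Z : ModuleCat.{0} A), χ Z → ∀ g : Z ⟶ Y, ¬ IsSplitEpi g →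
    ∃ h : Z ⟶ X, h ≫ f = g

def LeftAlmostSplitIn (χ : ModuleCat.{0} A → Prop) {X Y : ModuleCat.{0} A} (f : X ⟶ Y) : Prop :=
  ¬ IsSplitMono f ∧ ∀ (Z : ModuleCat.{0} A), χ Z → ∀ g : X ⟶ Z, ¬ IsSplitMono g →
    ∃ h : Y ⟶ Z, f ≫ h = g

def RightMinimal {X Y : ModuleCat.{0} A} (f : X ⟶ Y) : Prop :=
  ∀ h : X ⟶ X, h ≫ f = f → IsIso h

def LeftMinimal {X Y : ModuleCat.{0} A} (f : X ⟶ Y) : Prop :=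
  ∀ h : Y ⟶ Y, f ≫ h = f → IsIso h

def MinimalRightAlmostSplitIn (χ : ModuleCat.{0} A → Prop) {X Y : ModuleCat.{0} A}
    (f : X ⟶ Y) : Prop :=
  RightMinimal f ∧ RightAlmostSplitIn χ f

def MinimalLeftAlmostSplitIn (χ : ModuleCat.{0} A → Prop) {X Y : ModuleCat.{0} A}
    (f : X ⟶ Y) : Prop :=
  LeftMinimal f ∧ LeftAlmostSplitIn χ f

/-- `0 → X → Y → Z → 0` is a short exact sequence. -/
def IsSES {X Y Z : ModuleCat.{0} A} (f : X ⟶ Y) (g : Y ⟶ Z) : Prop :=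
  Function.Injective f ∧ Function.Surjective g ∧ Function.Exact f g

/-- `0 → X → Y → Z → 0` is an almost split sequence in `χ`. -/
def IsAlmostSplitSeq (χ : ModuleCat.{0} A → Prop) {X Y Z : ModuleCat.{0} A}
    (f : X ⟶ Y) (g : Y ⟶ Z) : Prop :=
  IsSES f g ∧ MinimalLeftAlmostSplitIn χ f ∧ MinimalRightAlmostSplitIn χ g

/-- `f : X → Y` is a right `χ`-approximation of `Y`. -/
def RightApprox (χ : ModuleCat.{0} A → Prop) {X Y : ModuleCat.{0} A} (f : X ⟶ Y) : Prop :=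
  χ X ∧ ∀ (Z : ModuleCat.{0} A), χ Z → ∀ g : Z ⟶ Y, ∃ h : Z ⟶ X, h ≫ f = g

def LeftApprox (χ : ModuleCat.{0} A → Prop) {X Y : ModuleCat.{0} A} (f : X ⟶ Y) : Prop :=
  χ Y ∧ ∀ (Z : ModuleCat.{0} A), χ Z → ∀ g : X ⟶ Z, ∃ h : Y ⟶ Z, f ≫ h = g

def MinimalRightApprox (χ : ModuleCat.{0} A → Prop) {X Y : ModuleCat.{0} A} (f : X ⟶ Y) : Prop :=
  RightApprox χ f ∧ RightMinimal f

def ContravariantlyFinite (χ : ModuleCat.{0} A → Prop) : Prop :=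
  ∀ Y : ModuleCat.{0} A, Module.Finite A Y → ∃ (X : ModuleCat.{0} A) (f : X ⟶ Y), RightApprox χ f

def CovariantlyFinite (χ : ModuleCat.{0} A → Prop) : Prop :=
  ∀ X : ModuleCat.{0} A, Module.Finite A X → ∃ (Y : ModuleCat.{0} A) (f : X ⟶ Y), LeftApprox χ f

def FunctoriallyFinite (χ : ModuleCat.{0} A → Prop) : Prop :=
  ContravariantlyFinite χ ∧ CovariantlyFinite χ

/-- `χ` is a subcategory of `A`-mod: its objects are finitely generated, and it is
closed under isomorphisms, finite direct sums and direct summands. -/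
def IsSubcat (χ : ModuleCat.{0} A → Prop) : Prop :=
  (∀ X : ModuleCat.{0} A, χ X → Module.Finite A X) ∧
  (∀ X Y : ModuleCat.{0} A, (X ≅ Y) → χ X → χ Y) ∧
  (∀ X Y : ModuleCat.{0} A, χ X → χ Y → χ (X ⊞ Y)) ∧
  (∀ X Y Z : ModuleCat.{0} A, (X ≅ Y ⊞ Z) → χ X → χ Y)

def ClosedUnderExtensions (χ : ModuleCat.{0} A → Prop) : Prop :=
  ∀ (X Y Z : ModuleCat.{0} A) (f : X ⟶ Y) (g : Y ⟶ Z), IsSES f g → χ X → χ Z → χ Y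

def ContainsProjectives (χ : ModuleCat.{0} A → Prop) : Prop :=
  ∀ P : ModuleCat.{0} A, Module.Finite A P → Projective P → χ P

/-- `Ω` is a resolving subcategory: closed under extensions, contains `A`, and is closed
under kernels of epimorphisms. -/
def Resolving (Ω : ModuleCat.{0} A → Prop) : Prop :=
  ClosedUnderExtensions Ω ∧ Ω (ModuleCat.of A A) ∧
  (∀ (X Y K : ModuleCat.{0} A) (f : X ⟶ Y) (i : K ⟶ X), Ω X → Ω Y →
    Function.Surjective f → Function.Injective i → Function.Exact i f → Ω K)

/-- `n` is the Jordan–Hölder length of the module `X`. -/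
def IsJHLength (X : ModuleCat.{0} A) (n : ℕ) : Prop :=
  ∃ s : CompositionSeries (Submodule A X), s.head = ⊥ ∧ s.last = ⊤ ∧ s.length = n

end Base

/-- An indecomposable module, phrased through complementary submodules. -/
def IndecMod (A X : Type*) [Ring A] [AddCommGroup X] [Module A X] : Prop :=
  Nontrivial X ∧ ∀ p q : Submodule A X, IsCompl p q → p = ⊥ ∨ q = ⊥

section Fitting
variable {A X : Type*} [Ring A] [AddCommGroup X] [Module A X] [IsArtinian A X] [IsNoetherian A X]

lemma IndecMod.isNilpotent_or_isUnit (hX : IndecMod A X) (u : Module.End A X) :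
    IsNilpotent u ∨ IsUnit u := by
  obtain ⟨N, hN⟩ := Filter.eventually_atTop.mp u.eventually_isCompl_ker_pow_range_pow
  have hc := hN (N + 1) (by lia)
  rcases hX.2 _ _ hc with h | h
  · right
    have hu : IsUnit (u ^ (N + 1)) := by
      rw [Module.End.isUnit_iff]
      refine ⟨LinearMap.ker_eq_bot.mp h, LinearMap.range_eq_top.mp ?_⟩
      rw [h] at hc
      exact eq_top_of_bot_isCompl hc
    exact (isUnit_pow_iff (Nat.succ_ne_zero N)).mp hu
  · left
    exact ⟨N + 1, LinearMap.range_eq_bot.mp h⟩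

lemma IndecMod.not_isUnit_add (hX : IndecMod A X) {a b : Module.End A X}
    (ha : ¬ IsUnit a) (hb : ¬ IsUnit b) : ¬ IsUnit (a + b) := by
  rintro ⟨u, hu⟩
  have hsum : (↑u⁻¹ : Module.End A X) * a + ↑u⁻¹ * b = 1 := by
    rw [← mul_add, ← hu, Units.inv_mul]
  rcases hX.isNilpotent_or_isUnit (↑u⁻¹ * a) with h | h
  · apply hb
    have h1 : IsUnit (↑u⁻¹ * b : Module.End A X) := by
      rw [eq_sub_iff_add_eq'.mpr hsum]
      exact h.isUnit_one_sub
    rwa [Units.isUnit_units_mul] at h1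
  · rw [Units.isUnit_units_mul] at h
    exact ha h

end Fitting

section Trace
variable {K A : Type*} [Field K] [Ring A] [Algebra K A]
  {X Z : Type*} [AddCommGroup X] [Module A X] [Module K X] [IsScalarTower K A X]
  [AddCommGroup Z] [Module A Z] [Module K Z] [IsScalarTower K A Z]

/-- Every linear form on `Z →ₗ[K] X` is given by the trace pairing. -/
lemma exists_dual_eq_trace [FiniteDimensional K X] [FiniteDimensional K Z]
    (ψ : (Z →ₗ[K] X) →ₗ[K] K) :
    ∃ s : X →ₗ[K] Z, ∀ h : Z →ₗ[K] X, ψ h = LinearMap.trace K X (h ∘ₗ s) := by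
  classical
  let b := Module.finBasis K Z
  let s : X →ₗ[K] Z :=
    { toFun := fun x => ∑ k, ψ ((b.coord k).smulRight x) • b k
      map_add' := by
        intro x y
        rw [← Finset.sum_add_distrib]
        refine Finset.sum_congr rfl fun k _ => ?_
        rw [← add_smul, ← map_add]
        congr 2
        ext z
        simp
      map_smul' := by
        intro c x
        rw [Finset.smul_sum]
        refine Finset.sum_congr rfl fun k _ => ?_
        rw [RingHom.id_apply, smul_smul, ← smul_eq_mul, ← map_smul ψ]
        congr 2
        ext z
        simp [smul_comm c] }
  refine ⟨s, fun h => ?_⟩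
  have hh : h = ∑ k, (b.coord k).smulRight (h (b k)) := by
    refine b.ext fun j => ?_
    simp [LinearMap.sum_apply, Finsupp.single_apply, ite_smul]
  rw [LinearMap.trace_comp_comm', LinearMap.trace_eq_matrix_trace K b]
  conv_lhs => rw [hh, map_sum]
  simp only [Matrix.trace, Matrix.diag, LinearMap.toMatrix_apply]
  refine Finset.sum_congr rfl fun k _ => ?_
  simp [s, Finsupp.single_apply]

lemma eq_zero_of_trace_eq_zero [FiniteDimensional K X] [FiniteDimensional K Z]
    (w : X →ₗ[K] Z) (H : ∀ h : Z →ₗ[K] X, LinearMap.trace K X (h ∘ₗ w) = 0) : w = 0 := by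
  by_contra hw
  obtain ⟨x, hx⟩ : ∃ x, w x ≠ 0 := by
    by_contra! hc
    exact hw (LinearMap.ext hc)
  obtain ⟨f, hf, -⟩ := Submodule.exists_le_ker_of_notMem (K := K) (p := (⊥ : Submodule K Z))
    (v := w x) (by simpa using hx)
  have h1 := H (f.smulRight x)
  rw [LinearMap.trace_comp_comm'] at h1
  have h2 : w ∘ₗ f.smulRight x = f.smulRight (w x) := by
    ext z
    simp
  rw [h2, LinearMap.trace_smulRight] at h1
  exact hf h1

/-- There is a `K`-endomorphism of an indecomposable module whose trace is one, and whose
trace against every non-invertible `A`-endomorphism vanishes. -/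
lemma IndecMod.exists_trace [FiniteDimensional K X] [IsArtinian A X] [IsNoetherian A X]
    (hX : IndecMod A X) : ∃ t : X →ₗ[K] X, LinearMap.trace K X t = 1 ∧
      ∀ u : Module.End A X, ¬ IsUnit u →
        LinearMap.trace K X (u.restrictScalars K ∘ₗ t) = 0 := by
  have := hX.1
  let I : Submodule K (X →ₗ[K] X) :=
    { carrier := {v | ∃ u : Module.End A X, ¬ IsUnit u ∧ u.restrictScalars K = v}
      zero_mem' := ⟨0, not_isUnit_zero, rfl⟩
      add_mem' := by
        rintro _ _ ⟨u, hu, rfl⟩ ⟨v, hv, rfl⟩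
        exact ⟨u + v, hX.not_isUnit_add hu hv, rfl⟩
      smul_mem' := by
        rintro c _ ⟨u, hu, rfl⟩
        have hcm : ∀ (a : A) (x : X), a • c • x = c • a • x := by
          intro a x
          rw [← algebraMap_smul A c x, ← algebraMap_smul A c (a • x), smul_smul, smul_smul,
            Algebra.commutes]
        let v : Module.End A X :=
          { toFun := fun x => c • u x
            map_add' := by simp
            map_smul' := by
              intro a x
              simp [hcm] }
        refine ⟨v, ?_, rfl⟩
        intro hv
        rw [Module.End.isUnit_iff] at hv
        apply hu
        rw [Module.End.isUnit_iff]
        have hc : c ≠ 0 := by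
          rintro rfl
          obtain ⟨x, hx⟩ := exists_ne (0 : X)
          obtain ⟨y, hy⟩ := hv.2 x
          exact hx (by rw [← hy]; simp [v])
        refine ⟨fun x y hxy => hv.1 (by simp [v, hxy]), fun y => ?_⟩
        obtain ⟨x, hx⟩ := hv.2 (c • y)
        exact ⟨x, smul_right_injective X hc hx⟩ }
  have h1 : (LinearMap.id : X →ₗ[K] X) ∉ I := by
    rintro ⟨u, hu, h⟩
    apply hu
    have : u = 1 := by
      ext x
      exact LinearMap.congr_fun h x
    rw [this]
    exact isUnit_one
  obtain ⟨φ, hφ, hI⟩ := Submodule.exists_le_ker_of_notMem h1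
  obtain ⟨s, hs⟩ := exists_dual_eq_trace φ
  refine ⟨(φ LinearMap.id)⁻¹ • s, ?_, ?_⟩
  · rw [map_smul]
    have := hs LinearMap.id
    rw [LinearMap.id_comp] at this
    rw [← this, smul_eq_mul, inv_mul_cancel₀ hφ]
  · intro u hu
    rw [LinearMap.comp_smul, map_smul, ← hs, show φ _ = 0 from hI ⟨u, hu, rfl⟩, smul_zero]

/-- A linear map of finite-dimensional modules which is orthogonal, for the trace pairing, to all
`A`-linear maps is a sum of commutators with generators of `A`. -/
lemma exists_eq_sum_commutator [FiniteDimensional K X] [FiniteDimensional K Z]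
    {ι : Type*} [Fintype ι] (a : Module.Basis ι K A) (w : X →ₗ[K] Z)
    (H : ∀ h : Z →ₗ[A] X, LinearMap.trace K X (h.restrictScalars K ∘ₗ w) = 0) :
    ∃ s : ι → X →ₗ[K] Z, ∀ x, w x = ∑ i, (a i • s i x - s i (a i • x)) := by
  classical
  let T : (Z →ₗ[K] X) →ₗ[K] (ι → Z →ₗ[K] X) := LinearMap.pi fun i =>
    LinearMap.lcomp K X (Algebra.lsmul K K Z (a i)) -
      LinearMap.compRight K (Algebra.lsmul K K X (a i))
  let ψ : (Z →ₗ[K] X) →ₗ[K] K := LinearMap.trace K X ∘ₗ LinearMap.lcomp K X w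
  have hT : ∀ h i z, T h i z = h (a i • z) - a i • h z := fun h i z => rfl
  have hψ : ψ ∈ (LinearMap.ker T).dualAnnihilator := by
    rw [Submodule.mem_dualAnnihilator]
    intro h hh
    rw [LinearMap.mem_ker] at hh
    have hl : ∀ (c : A) (z : Z), h (c • z) = c • h z := by
      intro c z
      rw [← a.sum_repr c]
      simp only [Finset.sum_smul, map_sum, smul_assoc, map_smul]
      refine Finset.sum_congr rfl fun i _ => ?_
      have := hT h i z
      rw [hh] at this
      rw [sub_eq_zero.mp this.symm]
    exact H { toFun := h, map_add' := h.map_add, map_smul' := hl }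
  rw [← LinearMap.range_dualMap_eq_dualAnnihilator_ker] at hψ
  obtain ⟨θ, hθ⟩ := hψ
  have hs : ∀ i, ∃ s : X →ₗ[K] Z, ∀ h : Z →ₗ[K] X,
      θ (Pi.single i h) = LinearMap.trace K X (h ∘ₗ s) := fun i =>
    exists_dual_eq_trace (θ ∘ₗ LinearMap.single K (fun _ : ι => Z →ₗ[K] X) i)
  choose s hs using hs
  refine ⟨s, ?_⟩
  have hw : w - ∑ i, ((Algebra.lsmul K K Z (a i)) ∘ₗ s i - s i ∘ₗ Algebra.lsmul K K X (a i)) =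
      0 := by
    refine eq_zero_of_trace_eq_zero _ fun h => ?_
    have h1 : ψ h = θ (T h) := by rw [← hθ]; rfl
    have h2 : T h = ∑ i, Pi.single i (T h i) := (Finset.univ_sum_single _).symm
    rw [h2, map_sum] at h1
    simp only [hs] at h1
    have hc : ∀ c : ι → X →ₗ[K] Z, h ∘ₗ ∑ i, c i = ∑ i, h ∘ₗ c i := fun c =>
      map_sum (LinearMap.compRight K h) c _
    rw [LinearMap.comp_sub, map_sub, show LinearMap.trace K X (h ∘ₗ w) = ψ h from rfl, h1,
      hc, map_sum, sub_eq_zero]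
    refine Finset.sum_congr rfl fun i _ => ?_
    have h3 : T h i = h ∘ₗ Algebra.lsmul K K Z (a i) - Algebra.lsmul K K X (a i) ∘ₗ h := rfl
    rw [h3, LinearMap.sub_comp, map_sub, LinearMap.comp_sub, map_sub]
    congr 1
    exact LinearMap.trace_comp_comm' (h ∘ₗ s i) (Algebra.lsmul K K X (a i))
  intro x
  have := LinearMap.congr_fun hw x
  simpa [LinearMap.sum_apply, sub_eq_zero] using this

end Trace

section LeftAlmostSplit
open TensorProduct

variable {K A : Type*} [Field K] [Ring A] [Algebra K A]
  {X : Type*} [AddCommGroup X] [Module A X] [Module K X] [IsScalarTower K A X]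
  {ι : Type*} (a : Module.Basis ι K A) (t : X →ₗ[K] X)

/-- The relations defining the middle term of a left almost split map. -/
noncomputable def middleRel : X →ₗ[K] X × (ι → A ⊗[K] X) :=
  LinearMap.prod (-t) (LinearMap.pi fun i =>
    Algebra.lsmul K K (A ⊗[K] X) (a i) ∘ₗ TensorProduct.mk K A X 1 -
      TensorProduct.mk K A X 1 ∘ₗ Algebra.lsmul K K X (a i))

lemma middleRel_apply (x : X) :
    middleRel a t x = (-t x, fun i => a i • ((1 : A) ⊗ₜ[K] x) - (1 : A) ⊗ₜ[K] (a i • x)) := rfl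

/-- The middle term of a left almost split map. -/
abbrev Middle : Type _ :=
  (X × (ι → A ⊗[K] X)) ⧸ Submodule.span A (Set.range (middleRel a t))

/-- The canonical map to the middle term; it is left almost split for suitable `t`. -/
noncomputable def toMiddle : X →ₗ[A] Middle a t :=
  Submodule.mkQ _ ∘ₗ LinearMap.inl A X (ι → A ⊗[K] X)

variable [Fintype ι] {Z : Type*} [AddCommGroup Z] [Module A Z] [Module K Z] [IsScalarTower K A Z]

lemma exists_comp_toMiddle (g : X →ₗ[A] Z) (s : ι → X →ₗ[K] Z)
    (hs : ∀ x, g (t x) = ∑ i, (a i • s i x - s i (a i • x))) :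
    ∃ h : Middle a t →ₗ[A] Z, h ∘ₗ toMiddle a t = g := by
  let σ : ι → A ⊗[K] X →ₗ[A] Z := fun i =>
    AlgebraTensorModule.lift (LinearMap.toSpanSingleton A (X →ₗ[K] Z) (s i))
  have hσ : ∀ i b x, σ i (b ⊗ₜ x) = b • s i x := fun i b x => rfl
  refine ⟨Submodule.liftQ _ (LinearMap.coprod g (∑ i, σ i ∘ₗ LinearMap.proj i)) ?_, ?_⟩
  · rw [Submodule.span_le]
    rintro _ ⟨x, rfl⟩
    simp only [SetLike.mem_coe, LinearMap.mem_ker, middleRel_apply, LinearMap.coprod_apply,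
      map_neg, hs, LinearMap.sum_apply, LinearMap.comp_apply, LinearMap.proj_apply, map_sub,
      map_smul, hσ, one_smul, neg_add_cancel]
  · ext x
    simp [toMiddle]

lemma exists_eq_sum_of_middle (r : Middle a t →ₗ[A] Z) :
    ∃ s : ι → X →ₗ[K] Z, ∀ x, r (toMiddle a t (t x)) =
      ∑ i, (a i • s i x - s i (a i • x)) := by
  classical
  let ρ : (X × (ι → A ⊗[K] X)) →ₗ[A] Z := r ∘ₗ Submodule.mkQ _
  let σ : ι → A ⊗[K] X →ₗ[A] Z := fun i =>
    ρ ∘ₗ LinearMap.inr A X (ι → A ⊗[K] X) ∘ₗ LinearMap.single A (fun _ => A ⊗[K] X) i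
  refine ⟨fun i => (σ i).restrictScalars K ∘ₗ TensorProduct.mk K A X 1, fun x => ?_⟩
  have h0 : ρ (middleRel a t x) = 0 := by
    have : (Submodule.span A (Set.range (middleRel a t))).mkQ (middleRel a t x) = 0 := by
      rw [← LinearMap.mem_ker, Submodule.ker_mkQ]
      exact Submodule.subset_span ⟨x, rfl⟩
    rw [LinearMap.comp_apply, this, map_zero]
  have h1 : ∀ v : ι → A ⊗[K] X, ρ (0, v) = ∑ i, σ i (v i) := by
    intro v
    calc ρ (0, v) = (ρ ∘ₗ LinearMap.inr A X (ι → A ⊗[K] X)) (∑ i, Pi.single i (v i)) := by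
          rw [Finset.univ_sum_single]; rfl
      _ = _ := by rw [map_sum]; rfl
  have h2 : middleRel a t x = -(t x, 0) + (0, fun i => a i • ((1 : A) ⊗ₜ[K] x) -
      (1 : A) ⊗ₜ[K] (a i • x)) := by
    rw [middleRel_apply]; simp
  rw [h2, map_add, map_neg, h1, neg_add_eq_zero] at h0
  refine (show r (toMiddle a t (t x)) = ρ (t x, 0) from rfl).trans (h0.trans ?_)
  simp only [map_sub, map_smul]
  rfl

lemma not_exists_retraction_toMiddle [FiniteDimensional K X] (ht : LinearMap.trace K X t ≠ 0)
    (r : Middle a t →ₗ[A] X) : r ∘ₗ toMiddle a t ≠ LinearMap.id := by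
  intro hr
  obtain ⟨s, hs⟩ := exists_eq_sum_of_middle a t r
  apply ht
  have h1 : t = ∑ i, ((Algebra.lsmul K K X (a i)) ∘ₗ s i - s i ∘ₗ Algebra.lsmul K K X (a i)) := by
    ext x
    have h2 := LinearMap.congr_fun hr (t x)
    rw [LinearMap.comp_apply, hs] at h2
    simpa [LinearMap.sum_apply] using h2.symm
  rw [h1, map_sum]
  refine Finset.sum_eq_zero fun i _ => ?_
  rw [map_sub, sub_eq_zero]
  exact LinearMap.trace_comp_comm' _ _

end LeftAlmostSplit

section Category
variable {A : Type} [Ring A]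

lemma Indec.indecMod {X : ModuleCat.{0} A} (hX : Indec X) : IndecMod A X := by
  refine ⟨hX.1, fun p q h => ?_⟩
  let e : X ⟶ X := ModuleCat.ofHom (p.projection q h)
  have he : e ≫ e = e := by
    ext x
    exact Submodule.projection_apply_of_mem_left h (Submodule.projection_apply_mem h x)
  rcases hX.2 e he with h0 | h0
  · left
    rw [eq_bot_iff]
    intro x hx
    have h1 := ConcreteCategory.congr_hom h0 x
    exact (Submodule.projection_apply_of_mem_left h hx).symm.trans h1
  · right
    rw [eq_bot_iff]
    intro x hx
    have h1 := ConcreteCategory.congr_hom h0 x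
    exact h1.symm.trans ((Submodule.projection_apply_eq_zero_iff h).mpr hx)

/-- Existence of left almost split maps in the category of finitely generated modules. -/
lemma exists_leftAlmostSplit (K : Type) [Field K] [Algebra K A] [FiniteDimensional K A]
    (X : ModuleCat.{0} A) [Module.Finite A X] (hX : Indec X) :
    ∃ (E : ModuleCat.{0} A) (f : X ⟶ E), Module.Finite A E ∧
      LeftAlmostSplitIn (fun Z => Module.Finite A Z) f := by
  have hA : IsArtinianRing A := IsArtinianRing.of_finite K A
  let _ : Module K X := Module.compHom X (algebraMap K A)
  have : IsScalarTower K A X := ⟨fun k a x => by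
    rw [Algebra.smul_def, mul_smul]; rfl⟩
  have : FiniteDimensional K X := Module.Finite.trans A X
  obtain ⟨t, ht1, ht⟩ := hX.indecMod.exists_trace (K := K)
  let a := Module.finBasis K A
  refine ⟨ModuleCat.of A (Middle a t), ModuleCat.ofHom (toMiddle a t), ?_, ?_, ?_⟩
  · change Module.Finite A (Middle a t)
    infer_instance
  · rintro ⟨⟨r⟩⟩
    refine not_exists_retraction_toMiddle a t (by rw [ht1]; exact one_ne_zero)
      r.retraction.hom ?_
    ext x
    exact ConcreteCategory.congr_hom r.id x
  · intro Z hZ g hg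
    let _ : Module K Z := Module.compHom Z (algebraMap K A)
    have : IsScalarTower K A Z := ⟨fun k a x => by
      rw [Algebra.smul_def, mul_smul]; rfl⟩
    have : FiniteDimensional K Z := Module.Finite.trans A Z
    obtain ⟨s, hs⟩ := exists_eq_sum_commutator a (g.hom.restrictScalars K ∘ₗ t) (by
      intro h
      refine ht (h ∘ₗ g.hom) fun hu => hg ?_
      obtain ⟨u, hu⟩ := hu
      refine IsSplitMono.mk' ⟨ModuleCat.ofHom ((↑u⁻¹ : Module.End A X) ∘ₗ h), ?_⟩
      ext x
      exact LinearMap.congr_fun (show (↑u⁻¹ : Module.End A X) * (h ∘ₗ g.hom) = 1 by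
        rw [← hu, Units.inv_mul]) x)
    obtain ⟨h, hh⟩ := exists_comp_toMiddle a t g.hom s hs
    refine ⟨ModuleCat.ofHom h, ?_⟩
    ext x
    exact LinearMap.congr_fun hh x

end Category

section HaradaSai
variable {A : Type*} [Ring A]

lemma length_range_comp_le {X Y Z W : Type*} [AddCommGroup X] [Module A X]
    [AddCommGroup Y] [Module A Y] [AddCommGroup Z] [Module A Z] [AddCommGroup W] [Module A W]
    [IsArtinian A Y] [IsNoetherian A Y] [IsArtinian A W] [IsNoetherian A W]
    (hY : IndecMod A Y) (hZ : IndecMod A Z) (f : X →ₗ[A] Y) (g : Y →ₗ[A] Z) (h : Z →ₗ[A] W)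
    (hg : ¬ Function.Bijective g) (c : ℕ) (hf : Module.length A (LinearMap.range f) ≤ c + 1)
    (hh : Module.length A (LinearMap.range h) ≤ c + 1) :
    Module.length A (LinearMap.range (h ∘ₗ g ∘ₗ f)) ≤ c := by
  by_contra! hc
  have hc1 : (c : ℕ∞) + 1 ≤ Module.length A (LinearMap.range (h ∘ₗ g ∘ₗ f)) :=
    Order.add_one_le_of_lt hc
  have hne : LinearMap.range (h ∘ₗ g ∘ₗ f) ≠ ⊥ := by
    intro h0
    rw [h0, Module.length_bot] at hc
    exact not_lt_zero hc
  have hle : LinearMap.range (h ∘ₗ g ∘ₗ f) ≤ LinearMap.range h := LinearMap.range_comp_le_range _ _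
  have hrange : LinearMap.range (h ∘ₗ g ∘ₗ f) = LinearMap.range h := by
    by_contra hn
    have := Submodule.height_strictMono (lt_of_le_of_ne hle hn)
    rw [← Module.length_submodule, ← Module.length_submodule] at this
    exact absurd (hh.trans hc1) (not_le.mpr this)
  have hker : ∀ x, h (g (f x)) = 0 → f x = 0 := by
    let φ : LinearMap.range f →ₗ[A] W := (h ∘ₗ g).domRestrict (LinearMap.range f)
    have hφ : LinearMap.range φ = LinearMap.range (h ∘ₗ g ∘ₗ f) := by
      rw [LinearMap.range_domRestrict, ← LinearMap.comp_assoc, LinearMap.range_comp f]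
    have hφk : LinearMap.ker φ = ⊥ := by
      by_contra hn
      have h1 := Submodule.length_quotient_lt (LinearMap.ker φ) hn
      rw [φ.quotKerEquivRange.length_eq, hφ] at h1
      exact absurd (hf.trans hc1) (not_le.mpr h1)
    intro x hx
    have h2 : (⟨f x, x, rfl⟩ : LinearMap.range f) ∈ LinearMap.ker φ := hx
    rw [hφk, Submodule.mem_bot] at h2
    exact congrArg Subtype.val h2
  have hsurj : ∀ z, ∃ x, h (g (f x)) = h z := fun z => by
    obtain ⟨x, hx⟩ : h z ∈ LinearMap.range (h ∘ₗ g ∘ₗ f) := hrange ▸ ⟨z, rfl⟩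
    exact ⟨x, hx⟩
  have hcY : IsCompl (LinearMap.range f) (LinearMap.ker (h ∘ₗ g)) := by
    refine ⟨Submodule.disjoint_def.mpr ?_, codisjoint_iff_le_sup.mpr fun y _ => ?_⟩
    · rintro _ ⟨x, rfl⟩ hx
      exact hker x hx
    · obtain ⟨x, hx⟩ := hsurj (g y)
      exact Submodule.mem_sup.mpr ⟨f x, ⟨x, rfl⟩, y - f x, by simp [hx], by simp⟩
  have hcZ : IsCompl (LinearMap.range (g ∘ₗ f)) (LinearMap.ker h) := by
    refine ⟨Submodule.disjoint_def.mpr ?_, codisjoint_iff_le_sup.mpr fun z _ => ?_⟩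
    · rintro _ ⟨x, rfl⟩ hx
      rw [LinearMap.comp_apply, hker x hx, map_zero]
    · obtain ⟨x, hx⟩ := hsurj z
      exact Submodule.mem_sup.mpr ⟨g (f x), ⟨x, rfl⟩, z - g (f x), by simp [hx], by simp⟩
  rcases hY.2 _ _ hcY with h0 | h0
  · rw [LinearMap.range_eq_bot] at h0
    exact hne (by simp [h0])
  rcases hZ.2 _ _ hcZ with h1 | h1
  · rw [LinearMap.range_eq_bot] at h1
    exact hne (by simp [h1])
  refine hg ⟨?_, ?_⟩
  · have := LinearMap.ker_eq_bot.mp h0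
    rw [LinearMap.coe_comp] at this
    exact this.of_comp
  · rw [h1] at hcZ
    have := LinearMap.range_eq_top.mp (eq_top_of_isCompl_bot hcZ)
    rw [LinearMap.coe_comp] at this
    exact this.of_comp

end HaradaSai

section Chains
variable {A : Type} [Ring A]

/-- `NonIsoChain P n f` says that `f` factors as a product of `n` non-isomorphisms between objects
satisfying `P`, followed by an arbitrary morphism. -/
def NonIsoChain (P : ModuleCat.{0} A → Prop) : ℕ → ∀ {X Y : ModuleCat.{0} A}, (X ⟶ Y) → Prop
  | 0, _, _, _ => True
  | n + 1, X, Y, f => ∃ (Z : ModuleCat.{0} A) (g : X ⟶ Z) (h : Z ⟶ Y),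
      P Z ∧ ¬ IsIso g ∧ NonIsoChain P n h ∧ g ≫ h = f

variable {P : ModuleCat.{0} A → Prop}

lemma NonIsoChain.split {n : ℕ} : ∀ {m : ℕ} {X Y : ModuleCat.{0} A} {f : X ⟶ Y}, P X →
    NonIsoChain P (m + (n + 1)) f →
    ∃ (U V : ModuleCat.{0} A) (f₁ : X ⟶ U) (g : U ⟶ V) (f₂ : V ⟶ Y), P U ∧ P V ∧
      NonIsoChain P m f₁ ∧ ¬ IsIso g ∧ NonIsoChain P n f₂ ∧ f₁ ≫ g ≫ f₂ = f
  | 0, X, Y, f, hX, hf => by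
    rw [Nat.zero_add] at hf
    obtain ⟨Z, g, h, hZ, hg, hh, rfl⟩ := hf
    exact ⟨X, Z, 𝟙 X, g, h, hX, hZ, trivial, hg, hh, Category.id_comp _⟩
  | m + 1, X, Y, f, hX, hf => by
    rw [Nat.succ_add] at hf
    obtain ⟨Z, g, h, hZ, hg, hh, rfl⟩ := hf
    obtain ⟨U, V, f₁, k, f₂, hU, hV, h₁, hk, h₂, rfl⟩ := NonIsoChain.split hZ hh
    exact ⟨U, V, g ≫ f₁, k, f₂, hU, hV, ⟨Z, g, f₁, hZ, hg, h₁, rfl⟩, hk, h₂, by simp⟩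

/-- The Harada–Sai lemma. -/
lemma NonIsoChain.length_range_le [IsArtinianRing A]
    (hP : ∀ X, P X → Module.Finite A X ∧ Indec X) :
    ∀ (m c : ℕ), (∀ X, P X → Module.length A X ≤ (c + m : ℕ)) →
    ∀ {X Y : ModuleCat.{0} A} {f : X ⟶ Y}, P X → P Y → NonIsoChain P (2 ^ m - 1) f →
      Module.length A (LinearMap.range f.hom) ≤ c
  | 0, c, hb, X, Y, f, hX, hY, _ =>
    (Module.length_le_of_injective _ (Submodule.injective_subtype _)).trans (hb Y hY)
  | m + 1, c, hb, X, Y, f, hX, hY, hf => by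
    have hN : 2 ^ (m + 1) - 1 = (2 ^ m - 1) + ((2 ^ m - 1) + 1) := by
      have := Nat.one_le_two_pow (n := m)
      rw [pow_succ]
      lia
    rw [hN] at hf
    obtain ⟨U, V, f₁, g, f₂, hU, hV, h₁, hg, h₂, rfl⟩ := NonIsoChain.split hX hf
    have hb' : ∀ X, P X → Module.length A X ≤ (c + 1 + m : ℕ) := fun X hX =>
      (hb X hX).trans_eq (by congr 1; lia)
    have := (hP U hU).1
    have := (hP Y hY).1
    refine length_range_comp_le (hP U hU).2.indecMod (hP V hV).2.indecMod f₁.hom g.hom f₂.hom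
      (fun h => hg ?_) c ?_ ?_
    · exact (ConcreteCategory.isIso_iff_bijective g).mpr h
    · exact_mod_cast NonIsoChain.length_range_le hP m (c + 1) hb' hX hU h₁
    · exact_mod_cast NonIsoChain.length_range_le hP m (c + 1) hb' hV hY h₂

end Chains

section Decomposition
variable {A : Type} [Ring A] {χ : ModuleCat.{0} A → Prop}

lemma IsSubcat.of_isCompl (hsub : IsSubcat χ) {X : ModuleCat.{0} A} (hX : χ X)
    {p q : Submodule A X} (h : IsCompl p q) : χ (ModuleCat.of A p) :=
  hsub.2.2.2 X (ModuleCat.of A p) (ModuleCat.of A q)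
    ((Submodule.prodEquivOfIsCompl p q h).symm.toModuleIso ≪≫
      (ModuleCat.biprodIsoProd (ModuleCat.of A p) (ModuleCat.of A q)).symm) hX

/-- Finitely generated modules over an artinian ring decompose into indecomposables. -/
lemma IsSubcat.exists_decomposition [IsArtinianRing A] (hsub : IsSubcat χ) :
    ∀ (n : ℕ) (X : ModuleCat.{0} A), χ X → Module.length A X ≤ n →
    ∃ (J : Type) (_ : Fintype J) (Y : J → ModuleCat.{0} A) (p : ∀ j, X ⟶ Y j)
      (i : ∀ j, Y j ⟶ X), (∀ j, χ (Y j) ∧ Indec (Y j)) ∧ ∑ j, p j ≫ i j = 𝟙 X := by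
  intro n
  induction n with
  | zero =>
    intro X hX hn
    have : Subsingleton X := Module.length_eq_zero_iff.mp (le_antisymm (by simpa using hn) bot_le)
    exact ⟨Empty, inferInstance, fun j => j.elim, fun j => j.elim, fun j => j.elim,
      fun j => j.elim, by ext x; exact Subsingleton.elim _ _⟩
  | succ n ih =>
    intro X hX hn
    have := hsub.1 X hX
    by_cases hI : Indec X
    · exact ⟨Unit, inferInstance, fun _ => X, fun _ => 𝟙 X, fun _ => 𝟙 X, fun _ => ⟨hX, hI⟩,
        by simp⟩
    by_cases hs : Nontrivial X
    swap
    · have : Subsingleton X := not_nontrivial_iff_subsingleton.mp hs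
      exact ⟨Empty, inferInstance, fun j => j.elim, fun j => j.elim, fun j => j.elim,
        fun j => j.elim, by ext x; exact Subsingleton.elim _ _⟩
    obtain ⟨e, he, he0, he1⟩ : ∃ e : X ⟶ X, e ≫ e = e ∧ e ≠ 0 ∧ e ≠ 𝟙 X := by
      by_contra! h
      exact hI ⟨hs, fun e he => or_iff_not_imp_left.mpr (h e he)⟩
    have hid : IsIdempotentElem e.hom := by
      ext x
      exact ConcreteCategory.congr_hom he x
    have hc : IsCompl (LinearMap.range e.hom) (LinearMap.ker e.hom) :=
      LinearMap.IsIdempotentElem.isCompl hid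
    have hp : LinearMap.range e.hom ≠ ⊤ := by
      intro h
      apply he1
      ext x
      obtain ⟨y, rfl⟩ := LinearMap.range_eq_top.mp h x
      exact ConcreteCategory.congr_hom he y
    have hq : LinearMap.ker e.hom ≠ ⊤ := by
      intro h
      apply he0
      ext x
      exact LinearMap.congr_fun (LinearMap.ker_eq_top.mp h) x
    generalize LinearMap.range e.hom = p at hc hp
    generalize LinearMap.ker e.hom = q at hc hq
    have hlt : ∀ {N : Submodule A X}, N ≠ ⊤ → Module.length A N ≤ n := fun hN => by
      have h1 := (Submodule.length_lt hN).trans_le hn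
      rw [Nat.cast_add, Nat.cast_one] at h1
      exact Order.le_of_lt_add_one h1
    obtain ⟨J, _, Y, π, ι, hY, hsum⟩ := ih (ModuleCat.of A p) (hsub.of_isCompl hX hc) (hlt hp)
    obtain ⟨J', _, Y', π', ι', hY', hsum'⟩ :=
      ih (ModuleCat.of A q) (hsub.of_isCompl hX hc.symm) (hlt hq)
    let α : X ⟶ ModuleCat.of A p := ModuleCat.ofHom (p.projectionOnto q hc)
    let β : ModuleCat.of A p ⟶ X := ModuleCat.ofHom p.subtype
    let α' : X ⟶ ModuleCat.of A q := ModuleCat.ofHom (q.projectionOnto p hc.symm)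
    let β' : ModuleCat.of A q ⟶ X := ModuleCat.ofHom q.subtype
    have hαβ : α ≫ β + α' ≫ β' = 𝟙 X := by
      ext x
      exact Submodule.projection_add_projection_eq_self hc x
    refine ⟨J ⊕ J', inferInstance, Sum.elim Y Y',
      fun j => match j with
        | .inl a => α ≫ π a
        | .inr b => α' ≫ π' b,
      fun j => match j with
        | .inl a => ι a ≫ β
        | .inr b => ι' b ≫ β', ?_, ?_⟩
    · rintro (j | j)
      exacts [hY j, hY' j]
    · rw [Fintype.sum_sum_type]
      change ∑ a, (α ≫ π a) ≫ ι a ≫ β + ∑ b, (α' ≫ π' b) ≫ ι' b ≫ β' = 𝟙 X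
      have h1 : ∀ a, (α ≫ π a) ≫ ι a ≫ β = α ≫ (π a ≫ ι a) ≫ β := by simp
      have h2 : ∀ a, (α' ≫ π' a) ≫ ι' a ≫ β' = α' ≫ (π' a ≫ ι' a) ≫ β' := by simp
      simp only [h1, h2]
      rw [← Preadditive.comp_sum, ← Preadditive.comp_sum, ← Preadditive.sum_comp,
        ← Preadditive.sum_comp, hsum, hsum', Category.id_comp, Category.id_comp, hαβ]

end Decomposition

section Finiteness
variable {A : Type} [Ring A] {χ : ModuleCat.{0} A → Prop}

lemma isIso_of_isSplitMono {X Y : ModuleCat.{0} A} (hX : Nontrivial X) (hY : Indec Y)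
    (f : X ⟶ Y) [IsSplitMono f] : IsIso f := by
  have h1 : f ≫ retraction f = 𝟙 X := IsSplitMono.id f
  rcases hY.2 (retraction f ≫ f) (by simp) with h | h
  · exfalso
    have h0 : 𝟙 X = 0 := by
      calc 𝟙 X = (f ≫ retraction f) ≫ (f ≫ retraction f) := by simp
        _ = f ≫ (retraction f ≫ f) ≫ retraction f := by simp
        _ = 0 := by rw [h]; simp
    obtain ⟨x, hx⟩ := exists_ne (0 : X)
    exact hx (ConcreteCategory.congr_hom h0 x)
  · exact ⟨retraction f, h1, h⟩

/-- Every indecomposable object of a covariantly finite subcategory has finitely many immediate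
successors, through which all non-isomorphisms to indecomposable objects factor. -/
lemma IsSubcat.exists_successors (K : Type) [Field K] [Algebra K A] [FiniteDimensional K A]
    (hsub : IsSubcat χ) (hcov : CovariantlyFinite χ)
    {X : ModuleCat.{0} A} (hχ : χ X) (hX : Indec X) :
    ∃ (J : Type) (_ : Fintype J) (Y : J → ModuleCat.{0} A) (g : ∀ j, X ⟶ Y j),
      (∀ j, (χ (Y j) ∧ Indec (Y j)) ∧ ¬ IsIso (g j)) ∧
      ∀ W, χ W → Indec W → ∀ f : X ⟶ W, ¬ IsIso f →
        ∃ h : ∀ j, Y j ⟶ W, ∑ j, g j ≫ h j = f := by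
  have : IsArtinianRing A := IsArtinianRing.of_finite K A
  have := hsub.1 X hχ
  obtain ⟨E, a, hE, ha, haf⟩ := exists_leftAlmostSplit K X hX
  obtain ⟨E', c, hE', hc⟩ := hcov E hE
  have := hsub.1 E' hE'
  obtain ⟨n, hn⟩ := ENat.ne_top_iff_exists.mp (Module.length_ne_top (R := A) (M := E'))
  obtain ⟨J, _, Y, p, i, hY, hsum⟩ := hsub.exists_decomposition n E' hE' hn.ge
  refine ⟨J, inferInstance, Y, fun j => a ≫ c ≫ p j, fun j => ⟨hY j, fun hiso => ha ?_⟩, ?_⟩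
  · exact IsSplitMono.mk' ⟨c ≫ p j ≫ inv (a ≫ c ≫ p j), by
      rw [← IsIso.hom_inv_id (a ≫ c ≫ p j)]; simp only [Category.assoc]⟩
  · intro W hW hWI f hf
    obtain ⟨f', hf'⟩ := haf W (hsub.1 W hW) f fun hs => hf (isIso_of_isSplitMono hX.1 hWI f)
    obtain ⟨f'', hf''⟩ := hc W hW f'
    refine ⟨fun j => i j ≫ f'', ?_⟩
    have h1 : ∀ j, (a ≫ c ≫ p j) ≫ i j ≫ f'' = (a ≫ c) ≫ (p j ≫ i j) ≫ f'' := by simp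
    simp only [h1]
    rw [← Preadditive.comp_sum, ← Preadditive.sum_comp, hsum, Category.id_comp, Category.assoc,
      hf'', hf']

lemma IsSubcat.exists_finite_or_chain (K : Type) [Field K] [Algebra K A] [FiniteDimensional K A]
    (hsub : IsSubcat χ) (hcov : CovariantlyFinite χ) (n : ℕ) :
    ∀ X, χ X → Indec X → ∃ S : Set (ModuleCat.{0} A), S.Finite ∧
      ∀ W, χ W → Indec W → (∃ Y ∈ S, Nonempty (W ≅ Y)) ∨
        ∀ (X₀ : ModuleCat.{0} A) (u : X₀ ⟶ X) (f : X ⟶ W), u ≫ f ≠ 0 →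
          ∃ f' : X ⟶ W, NonIsoChain (fun Z => χ Z ∧ Indec Z) n f' ∧ u ≫ f' ≠ 0 := by
  induction n with
  | zero =>
    exact fun X _ _ => ⟨∅, Set.finite_empty, fun W _ _ => .inr fun X₀ u f hf => ⟨f, trivial, hf⟩⟩
  | succ n ih =>
    intro X hχ hX
    obtain ⟨J, _, Y, g, hY, hg⟩ := hsub.exists_successors K hcov hχ hX
    choose S hS hSW using fun j => ih (Y j) (hY j).1.1 (hY j).1.2
    refine ⟨{X} ∪ ⋃ j, S j, (Set.finite_singleton X).union (Set.finite_iUnion hS), ?_⟩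
    intro W hW hWI
    refine or_iff_not_imp_left.mpr fun hnot X₀ u f hf => ?_
    obtain ⟨h, rfl⟩ := hg W hW hWI f fun hiso => hnot ⟨X, .inl rfl, ⟨(asIso f).symm⟩⟩
    rw [Preadditive.comp_sum] at hf
    obtain ⟨j, -, hj⟩ := Finset.exists_ne_zero_of_sum_ne_zero hf
    rcases hSW j W hW hWI with ⟨V, hV, hWV⟩ | hchain
    · exact absurd ⟨V, .inr (Set.mem_iUnion.mpr ⟨j, hV⟩), hWV⟩ hnot
    · obtain ⟨f', hf', hne⟩ := hchain X₀ (u ≫ g j) (h j) (by rwa [Category.assoc])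
      exact ⟨g j ≫ f', ⟨Y j, g j, f', (hY j).1, (hY j).2, hf', rfl⟩, by rwa [← Category.assoc]⟩

theorem IsSubcat.finite_of_length_le (K : Type) [Field K] [Algebra K A] [FiniteDimensional K A]
    (hsub : IsSubcat χ) (hcov : CovariantlyFinite χ)
    (hproj : ContainsProjectives χ) (b : ℕ)
    (hb : ∀ X, χ X → Indec X → Module.length A X ≤ b) :
    ∃ s : Set (ModuleCat.{0} A), s.Finite ∧
      ∀ X, χ X → Indec X → ∃ Y ∈ s, Nonempty (X ≅ Y) := by
  have : IsArtinianRing A := IsArtinianRing.of_finite K A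
  have hA : χ (ModuleCat.of A A) := hproj _ (inferInstanceAs (Module.Finite A A))
    ((IsProjective.iff_projective A).mp inferInstance)
  obtain ⟨n, hn⟩ := ENat.ne_top_iff_exists.mp (Module.length_ne_top (R := A) (M := A))
  obtain ⟨J, _, Y, p, i, hY, hsum⟩ := hsub.exists_decomposition n _ hA hn.ge
  choose S hS hSW using fun j =>
    hsub.exists_finite_or_chain K hcov (2 ^ b - 1) (Y j) (hY j).1 (hY j).2
  refine ⟨⋃ j, S j, Set.finite_iUnion hS, fun X hX hXI => ?_⟩
  by_contra hnot
  have := hXI.1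
  obtain ⟨x, hx⟩ := exists_ne (0 : X)
  let φ : ModuleCat.of A A ⟶ X := ModuleCat.ofHom (LinearMap.toSpanSingleton A X x)
  have hφ : (∑ j, p j ≫ i j) ≫ φ ≠ 0 := by
    rw [hsum, Category.id_comp]
    intro h0
    have h1 : φ (1 : A) = 0 := ConcreteCategory.congr_hom h0 (1 : A)
    exact hx (by simpa [φ] using h1)
  rw [Preadditive.sum_comp] at hφ
  obtain ⟨j, -, hj⟩ := Finset.exists_ne_zero_of_sum_ne_zero hφ
  rcases hSW j X hX hXI with ⟨V, hV, hXV⟩ | hchain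
  · exact hnot ⟨V, Set.mem_iUnion.mpr ⟨j, hV⟩, hXV⟩
  · obtain ⟨f', hf', hne⟩ := hchain _ (p j) (i j ≫ φ) (by rwa [← Category.assoc])
    have h1 := NonIsoChain.length_range_le (fun X hX => ⟨hsub.1 X hX.1, hX.2⟩) b 0
      (fun X hX => by simpa using hb X hX.1 hX.2) (hY j) ⟨hX, hXI⟩ hf'
    have h2 : Subsingleton (LinearMap.range f'.hom) :=
      Module.length_eq_zero_iff.mp (le_antisymm (by simpa using h1) bot_le)
    apply hne
    have h3 : f' = 0 := by
      ext y
      exact congrArg Subtype.val (Subsingleton.elim (⟨f' y, y, rfl⟩ : LinearMap.range f'.hom) 0)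
    rw [h3, Limits.comp_zero]

end Finiteness

lemma IsJHLength.length_eq {A : Type} [Ring A] {X : ModuleCat.{0} A} {n : ℕ}
    (h : IsJHLength X n) : Module.length A X = n := by
  obtain ⟨s, h₁, h₂, rfl⟩ := h
  exact (Module.length_compositionSeries s h₁ h₂).symm

/-!
Statement 10 (first Brauer–Thrall conjecture for subcategories): `χ` has only finitely
many isomorphism classes of indecomposable modules iff the Jordan–Hölder lengths of its
indecomposable modules are bounded.
-/

theorem stmt_10 {K : Type} [Field K] [IsAlgClosed K]
    {A : Type} [Ring A] [Algebra K A] [FiniteDimensional K A]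
    (χ : ModuleCat.{0} A → Prop)
    (hsub : IsSubcat χ) (hff : FunctoriallyFinite χ)
    (hext : ClosedUnderExtensions χ) (hproj : ContainsProjectives χ)
    (len : ModuleCat.{0} A → ℕ)
    (hlen : ∀ X : ModuleCat.{0} A, Module.Finite A X → IsJHLength X (len X)) :
    (∃ s : Set (ModuleCat.{0} A), s.Finite ∧
      ∀ X : ModuleCat.{0} A, χ X → Indec X → ∃ Y ∈ s, Nonempty (X ≅ Y)) ↔
    (∃ b : ℕ, ∀ X : ModuleCat.{0} A, χ X → Indec X → len X ≤ b) := by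
  constructor
  · rintro ⟨s, hs, h⟩
    obtain ⟨b, hb⟩ := (hs.image fun Y : ModuleCat.{0} A => (Module.length A Y).toNat).bddAbove
    refine ⟨b, fun X hX hXI => ?_⟩
    obtain ⟨Y, hY, ⟨e⟩⟩ := h X hX hXI
    have h1 : (Module.length A Y).toNat ≤ b := hb ⟨Y, hY, rfl⟩
    rwa [← e.toLinearEquiv.length_eq, (hlen X (hsub.1 X hX)).length_eq, ENat.toNat_natCast] at h1
  · rintro ⟨b, hb⟩
    refine IsSubcat.finite_of_length_le K hsub hff.2 hproj b fun X hX hXI => ?_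
    rw [(hlen X (hsub.1 X hX)).length_eq]
    exact_mod_cast hb X hX hXI
end

section
/- Let χ be a functorially finite subcategory of A-mod closed under extensions and containing all projective modules, and let X_0 →f₁ X_1 →f₂ ⋯ →fₙ X_n = X_0 (n ≥ 1) be an oriented cycle of χ-irreducible morphisms between indecomposable modules in χ. Then some f_i has finite left degree in χ and some f_j has finite right degree in χ. -/
open CategoryTheory Limits

universe u

section Radical
variable {A : Type} [Ring A]

/-- The radical `rad_χ(X,Y)`. -/
def RadIn (χ : ModuleCat.{0} A → Prop) (X Y : ModuleCat.{0} A) : Set (X ⟶ Y) :=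
  {f | ∀ (Z : ModuleCat.{0} A), χ Z → Indec Z → ∀ (h : Z ⟶ X) (g : Y ⟶ Z),
    ¬ IsIso (h ≫ f ≫ g)}

/-- Powers `rad_χ^n(X,Y)` of the radical (with `rad_χ^0 = Hom`). -/
def RadPow (χ : ModuleCat.{0} A → Prop) : ℕ → ∀ (X Y : ModuleCat.{0} A), Set (X ⟶ Y)
  | 0, _, _ => Set.univ
  | 1, X, Y => RadIn χ X Y
  | (n+2), X, Y => {f | ∃ (Z : ModuleCat.{0} A), χ Z ∧ ∃ (h : X ⟶ Z) (g : Z ⟶ Y),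
      h ∈ RadIn χ X Z ∧ g ∈ RadPow χ (n+1) Z Y ∧ f = h ≫ g}

end Radical
section Degrees
variable {A : Type} [Ring A]

/-- The left degree `d^l_χ(f)` of an irreducible morphism: the least `n ≥ 1` such that
some `g ∈ rad_χ^n(Z,X) \ rad_χ^{n+1}(Z,X)` satisfies `f∘g ∈ rad_χ^{n+2}(Z,Y)`;
`∞` if no such `n` exists. -/
noncomputable def leftDeg (χ : ModuleCat.{0} A → Prop) {X Y : ModuleCat.{0} A}
    (f : X ⟶ Y) : ℕ∞ :=
  sInf {d : ℕ∞ | ∃ m : ℕ, d = (m : ℕ∞) ∧ 1 ≤ m ∧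
    ∃ (Z : ModuleCat.{0} A), χ Z ∧ ∃ g : Z ⟶ X,
      g ∈ RadPow χ m Z X ∧ g ∉ RadPow χ (m + 1) Z X ∧
      (g ≫ f) ∈ RadPow χ (m + 2) Z Y}

/-- The right degree `d^r_χ(f)` of an irreducible morphism: the least `n ≥ 1` such that
some `g ∈ rad_χ^n(Y,Z) \ rad_χ^{n+1}(Y,Z)` satisfies `g∘f ∈ rad_χ^{n+2}(X,Z)`;
`∞` if no such `n` exists. -/
noncomputable def rightDeg (χ : ModuleCat.{0} A → Prop) {X Y : ModuleCat.{0} A}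
    (f : X ⟶ Y) : ℕ∞ :=
  sInf {d : ℕ∞ | ∃ m : ℕ, d = (m : ℕ∞) ∧ 1 ≤ m ∧
    ∃ (Z : ModuleCat.{0} A), χ Z ∧ ∃ g : Y ⟶ Z,
      g ∈ RadPow χ m Y Z ∧ g ∉ RadPow χ (m + 1) Y Z ∧
      (f ≫ g) ∈ RadPow χ (m + 2) X Z}

end Degrees
section CyclePaths
variable {A : Type} [Ring A]

/-- A radical endomorphism of an indecomposable object of `χ` is not invertible. -/
lemma not_isIso_of_mem_radIn {χ : ModuleCat.{0} A → Prop} {X : ModuleCat.{0} A} (hX : χ X)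
    (hXi : Indec X) {f : X ⟶ X} (hf : f ∈ RadIn χ X X) : ¬ IsIso f := by
  simpa using hf X hX hXi (𝟙 X) (𝟙 X)

lemma zero_mem_radIn (χ : ModuleCat.{0} A → Prop) (X Y : ModuleCat.{0} A) :
    (0 : X ⟶ Y) ∈ RadIn χ X Y := by
  intro Z _ hZ h g hiso
  have : Nontrivial Z := hZ.1
  rw [zero_comp, comp_zero] at hiso
  obtain ⟨z, hz⟩ := exists_ne (0 : Z)
  apply hz
  have hid : 0 = 𝟙 Z := by rw [← IsIso.hom_inv_id (0 : Z ⟶ Z), zero_comp]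
  have := congrArg (fun φ : Z ⟶ Z => φ.hom z) hid
  simpa using this.symm

lemma comp_mem_radIn {χ : ModuleCat.{0} A → Prop} {X Y Z : ModuleCat.{0} A} {f : X ⟶ Y}
    (hf : f ∈ RadIn χ X Y) (g : Y ⟶ Z) : f ≫ g ∈ RadIn χ X Z := by
  intro W hW hWi h k
  simpa using hf W hW hWi h (g ≫ k)

lemma zero_mem_radPow (χ : ModuleCat.{0} A → Prop) {X : ModuleCat.{0} A} (hX : χ X)
    (Y : ModuleCat.{0} A) : ∀ m : ℕ, (0 : X ⟶ Y) ∈ RadPow χ m X Y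
  | 0 => Set.mem_univ _
  | 1 => zero_mem_radIn χ X Y
  | m + 2 => ⟨X, hX, 0, 0, zero_mem_radIn χ X X, zero_mem_radPow χ hX Y (m + 1), by simp⟩

lemma radPow_succ_subset_radIn (χ : ModuleCat.{0} A → Prop) {X Y : ModuleCat.{0} A} :
    ∀ m : ℕ, RadPow χ (m + 1) X Y ⊆ RadIn χ X Y
  | 0, _, hf => hf
  | _ + 1, _, ⟨_, _, _, g, hh, _, e⟩ => e ▸ comp_mem_radIn hh g

lemma radPow_comp_radIn {χ : ModuleCat.{0} A → Prop} {Y Z : ModuleCat.{0} A} (hY : χ Y)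
    {f : Y ⟶ Z} (hf : f ∈ RadIn χ Y Z) :
    ∀ (m : ℕ) {X : ModuleCat.{0} A} {g : X ⟶ Y}, g ∈ RadPow χ (m + 1) X Y →
      g ≫ f ∈ RadPow χ (m + 2) X Z
  | 0, _, g, hg => ⟨Y, hY, g, f, hg, hf, rfl⟩
  | m + 1, _, _, ⟨W, hW, h, k, hh, hk, e⟩ =>
    ⟨W, hW, h, k ≫ f, hh, radPow_comp_radIn hY hf m hk, by rw [e, Category.assoc]⟩

/-- In an indecomposable object, a split monomorphism from a nontrivial object is
invertible. -/
lemma Indec.isIso_of_retraction {X Z : ModuleCat.{0} A} (hX : Indec X) [Nontrivial Z]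
    {h : Z ⟶ X} {r : X ⟶ Z} (hr : h ≫ r = 𝟙 Z) : IsIso h := by
  refine ⟨r, hr, ?_⟩
  refine (hX.2 (r ≫ h) (by rw [Category.assoc, reassoc_of% hr])).resolve_left fun h0 => ?_
  obtain ⟨z, hz⟩ := exists_ne (0 : Z)
  have hid : h ≫ (r ≫ h) ≫ r = 𝟙 Z := by simp [hr]
  rw [h0, zero_comp, comp_zero] at hid
  apply hz
  have := congrArg (fun φ : Z ⟶ Z => φ.hom z) hid
  simpa using this.symm

lemma IrredIn.mem_radIn {χ : ModuleCat.{0} A → Prop} {X Y : ModuleCat.{0} A} {f : X ⟶ Y}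
    (hf : IrredIn χ f) (hXi : Indec X) : f ∈ RadIn χ X Y := by
  intro Z _ hZi h g hiso
  have : Nontrivial Z := hZi.1
  have hr : h ≫ (f ≫ g ≫ inv (h ≫ f ≫ g)) = 𝟙 Z := by
    simpa only [Category.assoc] using IsIso.hom_inv_id (h ≫ f ≫ g)
  have hh : IsIso h := hXi.isIso_of_retraction hr
  refine hf.1 (IsSplitMono.mk' ⟨g ≫ inv (h ≫ f ≫ g) ≫ h, ?_⟩)
  rw [← cancel_epi h, reassoc_of% hr, Category.comp_id]

lemma IrredIn.notMem_radPow_two {χ : ModuleCat.{0} A → Prop} {X Y : ModuleCat.{0} A}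
    {f : X ⟶ Y} (hf : IrredIn χ f) (hX : χ X) (hY : χ Y) (hXi : Indec X) (hYi : Indec Y) :
    f ∉ RadPow χ 2 X Y := by
  rintro ⟨Z, hZ, h, g, hh, hg, e⟩
  rcases hf.2.2 Z hZ h g e with hs | hs
  · apply hh X hX hXi (𝟙 X) (retraction h)
    rw [Category.id_comp, IsSplitMono.id]
    infer_instance
  · apply hg Y hY hYi (section_ g) (𝟙 Y)
    rw [Category.comp_id, IsSplitEpi.id]
    infer_instance

lemma comp_notMem_radPow_of_leftDeg_eq_top {χ : ModuleCat.{0} A → Prop} {X Y Z : ModuleCat.{0} A}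
    {f : X ⟶ Y} (hf : leftDeg χ f = ⊤) {m : ℕ} (hm : 1 ≤ m) (hZ : χ Z) {g : Z ⟶ X}
    (hg : g ∈ RadPow χ m Z X) (hg' : g ∉ RadPow χ (m + 1) Z X) :
    g ≫ f ∉ RadPow χ (m + 2) Z Y := fun h =>
  ENat.natCast_ne_top m (sInf_eq_top.1 hf m ⟨m, rfl, hm, Z, hZ, g, hg, hg', h⟩)

lemma comp_notMem_radPow_of_rightDeg_eq_top {χ : ModuleCat.{0} A → Prop} {X Y Z : ModuleCat.{0} A}
    {f : X ⟶ Y} (hf : rightDeg χ f = ⊤) {m : ℕ} (hm : 1 ≤ m) (hZ : χ Z) {g : Y ⟶ Z}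
    (hg : g ∈ RadPow χ m Y Z) (hg' : g ∉ RadPow χ (m + 1) Y Z) :
    f ≫ g ∉ RadPow χ (m + 2) X Z := fun h =>
  ENat.natCast_ne_top m (sInf_eq_top.1 hf m ⟨m, rfl, hm, Z, hZ, g, hg, hg', h⟩)

/-- Fitting's lemma: a non-invertible endomorphism of an indecomposable module of finite
length is nilpotent. -/
lemma Indec.exists_pow_eq_zero {X : ModuleCat.{0} A} (hX : Indec X) [IsArtinian A X]
    [IsNoetherian A X] {c : X ⟶ X} (hc : ¬ IsIso c) :
    ∃ m : ℕ, 0 < m ∧ c.hom ^ m = 0 := by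
  obtain ⟨N, hN⟩ := Filter.eventually_atTop.1 c.hom.eventually_isCompl_ker_pow_range_pow
  have hcompl := hN (N + 1) N.le_succ
  refine ⟨N + 1, N.succ_pos, ?_⟩
  set p := Submodule.projection _ _ hcompl with hp
  have hpp : p * p = p := Submodule.isIdempotentElem_projection hcompl
  have hker : LinearMap.ker p = LinearMap.range (c.hom ^ (N + 1)) :=
    Submodule.ker_projection hcompl
  have hrange : LinearMap.range p = LinearMap.ker (c.hom ^ (N + 1)) :=
    Submodule.range_projection hcompl
  rcases hX.2 (ModuleCat.ofHom p) (ModuleCat.hom_ext hpp) with h | h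
  · have h0 : p = 0 := congrArg ModuleCat.Hom.hom h
    rw [h0, LinearMap.ker_zero] at hker
    rw [h0, LinearMap.range_zero] at hrange
    have hu : IsUnit (c.hom ^ (N + 1)) :=
      (Module.End.isUnit_iff _).2
        ⟨LinearMap.ker_eq_bot.1 hrange.symm, LinearMap.range_eq_top.1 hker.symm⟩
    have hb := (Module.End.isUnit_iff _).1 ((isUnit_pow_iff N.succ_ne_zero).1 hu)
    exact absurd ((ConcreteCategory.isIso_iff_bijective c).2 hb) hc
  · have h1 : p = LinearMap.id := congrArg ModuleCat.Hom.hom h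
    rw [h1, LinearMap.ker_id] at hker
    exact LinearMap.range_eq_bot.1 hker.symm

/-- `CyclePath f k i j g` says that `g` is the composite of the `k` consecutive morphisms
of the cycle `f` leading from `X i` to `X j`. -/
inductive CyclePath {n : ℕ} {X : ZMod n → ModuleCat.{0} A} (f : ∀ i : ZMod n, X i ⟶ X (i + 1)) :
    ℕ → ∀ i j : ZMod n, (X i ⟶ X j) → Prop
  | nil (i : ZMod n) : CyclePath f 0 i i (𝟙 (X i))
  | snoc {k : ℕ} {i j : ZMod n} {g : X i ⟶ X j} :
      CyclePath f k i j g → CyclePath f (k + 1) i (j + 1) (g ≫ f j)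

namespace CyclePath
variable {n : ℕ} {X : ZMod n → ModuleCat.{0} A} {f : ∀ i : ZMod n, X i ⟶ X (i + 1)}

lemma exists_of_length (f : ∀ i : ZMod n, X i ⟶ X (i + 1)) (k : ℕ) (i : ZMod n) :
    ∃ g, CyclePath f k i (i + k) g := by
  induction k with
  | zero => rw [Nat.cast_zero, add_zero]; exact ⟨_, nil i⟩
  | succ k ih =>
    obtain ⟨g, hg⟩ := ih
    rw [Nat.cast_succ, ← add_assoc]
    exact ⟨_, hg.snoc⟩

lemma comp {k : ℕ} {i j : ZMod n} {g : X i ⟶ X j} (hg : CyclePath f k i j g) {l : ℕ}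
    {m : ZMod n} {h : X j ⟶ X m} (hh : CyclePath f l j m h) :
    CyclePath f (k + l) i m (g ≫ h) := by
  induction hh with
  | nil => simpa using hg
  | snoc _ ih =>
    rw [← Category.assoc, ← add_assoc]
    exact (ih hg).snoc

lemma pow {k : ℕ} {i : ZMod n} {c : X i ⟶ X i} (hc : CyclePath f k i i c) (m : ℕ) :
    CyclePath f (k * m) i i (ModuleCat.ofHom (c.hom ^ m)) := by
  induction m with
  | zero => exact nil i
  | succ m ih =>
    have h := hc.comp ih
    rw [pow_succ, Nat.mul_succ, Nat.add_comm]
    exact h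

lemma exists_cons {k : ℕ} {i j : ZMod n} {g : X i ⟶ X j} (hg : CyclePath f (k + 1) i j g) :
    ∃ h, CyclePath f k (i + 1) j h ∧ g = f i ≫ h := by
  induction k generalizing j with
  | zero =>
    cases hg with
    | snoc hg => cases hg with
      | nil => exact ⟨𝟙 _, nil _, by simp⟩
  | succ k ih =>
    cases hg with
    | snoc hg =>
      obtain ⟨h, hh, rfl⟩ := ih hg
      exact ⟨_, hh.snoc, Category.assoc _ _ _⟩

variable {χ : ModuleCat.{0} A → Prop}

lemma mem_radPow (hX : ∀ i, χ (X i)) (hf : ∀ i, f i ∈ RadIn χ (X i) (X (i + 1))) {k : ℕ}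
    {i j : ZMod n} {g : X i ⟶ X j} (hg : CyclePath f k i j g) : g ∈ RadPow χ k (X i) (X j) := by
  induction hg with
  | nil => exact Set.mem_univ _
  | @snoc k i j g hg ih =>
    cases k with
    | zero =>
      cases hg with
      | nil => rw [Category.id_comp]; exact hf i
    | succ k => exact radPow_comp_radIn (hX _) (hf _) k ih

/-- If all left degrees are infinite, composites of length `k + 1` lie outside
`rad_χ ^ (k + 2)`. -/
lemma notMem_radPow_of_leftDeg (hX : ∀ i, χ (X i)) (hf : ∀ i, f i ∈ RadIn χ (X i) (X (i + 1)))
    (hf2 : ∀ i, f i ∉ RadPow χ 2 (X i) (X (i + 1))) (hdeg : ∀ i, leftDeg χ (f i) = ⊤) {k : ℕ}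
    {i j : ZMod n} {g : X i ⟶ X j} (hg : CyclePath f (k + 1) i j g) :
    g ∉ RadPow χ (k + 2) (X i) (X j) := by
  induction k generalizing j with
  | zero =>
    obtain ⟨h, hh, rfl⟩ := hg.exists_cons
    cases hh with
    | nil => rw [Category.comp_id]; exact hf2 i
  | succ k ih =>
    cases hg with
    | snoc hg =>
      exact comp_notMem_radPow_of_leftDeg_eq_top (hdeg _) k.succ_pos (hX i) (hg.mem_radPow hX hf) (ih hg)

/-- If all right degrees are infinite, composites of length `k + 1` lie outside
`rad_χ ^ (k + 2)`. -/
lemma notMem_radPow_of_rightDeg (hX : ∀ i, χ (X i)) (hf : ∀ i, f i ∈ RadIn χ (X i) (X (i + 1)))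
    (hf2 : ∀ i, f i ∉ RadPow χ 2 (X i) (X (i + 1))) (hdeg : ∀ i, rightDeg χ (f i) = ⊤) {k : ℕ}
    {i j : ZMod n} {g : X i ⟶ X j} (hg : CyclePath f (k + 1) i j g) :
    g ∉ RadPow χ (k + 2) (X i) (X j) := by
  induction k generalizing i with
  | zero =>
    obtain ⟨h, hh, rfl⟩ := hg.exists_cons
    cases hh with
    | nil => rw [Category.comp_id]; exact hf2 i
  | succ k ih =>
    obtain ⟨h, hh, rfl⟩ := hg.exists_cons
    exact comp_notMem_radPow_of_rightDeg_eq_top (hdeg _) k.succ_pos (hX j) (hh.mem_radPow hX hf) (ih hh)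

/-- Going around a cycle of radical morphisms often enough gives zero. -/
lemma exists_zero (hn : 0 < n) (hX : ∀ i, χ (X i)) (hXi : ∀ i, Indec (X i))
    (hf : ∀ i, f i ∈ RadIn χ (X i) (X (i + 1))) [IsArtinian A (X 0)] [IsNoetherian A (X 0)] :
    ∃ k : ℕ, CyclePath f (k + 1) 0 0 0 := by
  obtain ⟨c, hc⟩ : ∃ c, CyclePath f n 0 0 c := by
    have h := exists_of_length f n 0
    rwa [ZMod.natCast_self, add_zero] at h
  have hrad : c ∈ RadIn χ (X 0) (X 0) := by
    obtain ⟨n, rfl⟩ := Nat.exists_eq_succ_of_ne_zero hn.ne'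
    exact radPow_succ_subset_radIn χ n (hc.mem_radPow hX hf)
  obtain ⟨m, hm, hm0⟩ := (hXi 0).exists_pow_eq_zero (not_isIso_of_mem_radIn (hX 0) (hXi 0) hrad)
  obtain ⟨k, hk⟩ := Nat.exists_eq_succ_of_ne_zero (Nat.mul_pos hn hm).ne'
  have h := hc.pow m
  rw [hm0, hk] at h
  exact ⟨k, h⟩

end CyclePath
end CyclePaths

/-!
Statement 17: every oriented cycle of `χ`-irreducible morphisms between indecomposable
modules in the Auslander–Reiten quiver of `χ` contains an arrow of finite left degree
and an arrow of finite right degree.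
-/

theorem stmt_17 {K : Type} [Field K] [IsAlgClosed K]
    {A : Type} [Ring A] [Algebra K A] [FiniteDimensional K A]
    (χ : ModuleCat.{0} A → Prop)
    (hsub : IsSubcat χ) (hff : FunctoriallyFinite χ)
    (hext : ClosedUnderExtensions χ) (hproj : ContainsProjectives χ)
    (n : ℕ) (hn : 0 < n)
    -- an oriented cycle `X 0 → X 1 → ⋯ → X n = X 0`, indexed cyclically
    (X : ZMod n → ModuleCat.{0} A) (f : ∀ i : ZMod n, X i ⟶ X (i + 1))
    (hXχ : ∀ i, χ (X i)) (hXind : ∀ i, Indec (X i))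
    (hirr : ∀ i, IrredIn χ (f i)) :
    (∃ i : ZMod n, leftDeg χ (f i) < ⊤) ∧ (∃ j : ZMod n, rightDeg χ (f j) < ⊤) := by
  have hf i : f i ∈ RadIn χ (X i) (X (i + 1)) := (hirr i).mem_radIn (hXind i)
  have hf2 i : f i ∉ RadPow χ 2 (X i) (X (i + 1)) :=
    (hirr i).notMem_radPow_two (hXχ i) (hXχ _) (hXind i) (hXind _)
  have : IsArtinianRing A := IsArtinianRing.of_finite K A
  have : Module.Finite A (X 0) := hsub.1 _ (hXχ 0)
  obtain ⟨k, hk⟩ := CyclePath.exists_zero hn hXχ hXind hf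
  have h0 := zero_mem_radPow χ (hXχ 0) (X 0) (k + 2)
  constructor
  · by_contra! h
    exact hk.notMem_radPow_of_leftDeg hXχ hf hf2 (fun i => top_le_iff.1 (h i)) h0
  · by_contra! h
    exact hk.notMem_radPow_of_rightDeg hXχ hf hf2 (fun i => top_le_iff.1 (h i)) h0
end

section
/- Let Q be a finite quiver with vertices e_1,…,e_n, without loops and without oriented cycles, and for vertices i,j let p(i,j) denote the number of directed paths from e_i to e_j (counting the trivial path when i = j). Let i_j ∈ ℤⁿ be the column vector with k-th entry p(k,j) and p_j ∈ ℤⁿ the column vector with k-th entry p(j,k) (the dimension vectors of the indecomposable injective and projective KQ-modules). Since Q is acyclic, the vectors i_1,…,i_n form a ℤ-basis of ℤⁿ, so there is a unique invertible matrix C ∈ M_n(ℤ) (the Coxeter matrix of Q) with C·i_j = −p_j for all j. Then the inverse C^{-1} = (c_{ij}) satisfies c_{ij} = −p(i,j) + Σ_α p(i,k(α)), where the sum runs over all arrows α of Q starting at e_j and k(α) denotes the target of α; dually, C = (d_{ij}) satisfies d_{ij} = −p(j,i) + Σ_β p(k(β),i), where the sum runs over all arrows β of Q ending at e_j and k(β)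 denotes the source of β. -/
/-!
Statement 19: Combinatorial description of the entries of the Coxeter matrix of a finite
acyclic quiver without loops, and of its inverse, in terms of path counts.
`p i j` is the number of directed paths from `e_i` to `e_j` (the trivial path counted
when `i = j`); `C` is the unique invertible integer matrix with `C · i_j = −p_j`, where
`i_j` (resp. `p_j`) is the vector of path counts into (resp. out of) the vertex `j`.
Then `C⁻¹ = (c_{ij})` with `c_{ij} = −p(i,j) + Σ_{α : e_j → k(α)} p(i, k(α))`, and
`C = (d_{ij})` with `d_{ij} = −p(j,i) + Σ_{β : k(β) → e_j} p(k(β), i)`.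
-/

open Quiver in
/-- A path is either trivial or a path followed by a last arrow. -/
def pathEquivLastArrow {V : Type*} [Quiver V] (i j : V) :
    Path i j ≃ PLift (i = j) ⊕ Σ k : V, Path i k × (k ⟶ j) where
  toFun q := match q with
    | .nil => .inl ⟨rfl⟩
    | .cons q a => .inr ⟨_, q, a⟩
  invFun x := match x with
    | .inl ⟨h⟩ => h ▸ .nil
    | .inr ⟨_, q, a⟩ => q.cons a
  left_inv q := by cases q <;> rfl
  right_inv x := by
    rcases x with ⟨⟨rfl⟩⟩ | ⟨_, _, _⟩ <;> rfl

open Quiver in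
theorem finite_path_of_acyclic {V : Type*} [Finite V] [Quiver V]
    [∀ i j : V, Finite (i ⟶ j)] (hacyclic : ∀ (i : V) (q : Path i i), q.length = 0)
    (i j : V) : Finite (Path i j) := by
  let r : V → V → Prop := fun k l => ∃ q : Path k l, 0 < q.length
  have : IsTrans V r := ⟨fun _ _ _ ⟨q, hq⟩ ⟨s, _⟩ => ⟨q.comp s, by simp; omega⟩⟩
  have : Std.Irrefl r := ⟨fun k ⟨q, hq⟩ => hq.ne' (hacyclic k q)⟩
  induction j using (Finite.wellFounded_of_trans_of_irrefl r).induction with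
  | _ j ih =>
    have (k : V) : Finite (Path i k × (k ⟶ j)) := by
      rcases isEmpty_or_nonempty (k ⟶ j) with _ | ⟨⟨a⟩⟩
      · infer_instance
      · have := ih k ⟨a.toPath, by simp⟩
        infer_instance
    exact Finite.of_equiv _ (pathEquivLastArrow i j).symm

open Quiver in
theorem card_path_eq_of_acyclic {V : Type*} [Fintype V] [DecidableEq V] [Quiver V]
    [∀ i j : V, Fintype (i ⟶ j)] (hacyclic : ∀ (i : V) (q : Path i i), q.length = 0)
    (i j : V) : Nat.card (Path i j) =
      (if i = j then 1 else 0) + ∑ k, Nat.card (Path i k) * Fintype.card (k ⟶ j) := by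
  have := finite_path_of_acyclic hacyclic
  rw [Nat.card_congr (pathEquivLastArrow i j), Nat.card_sum, Nat.card_sigma]
  simp only [Nat.card_prod, Nat.card_eq_fintype_card (α := _ ⟶ _)]
  congr 1
  split_ifs with h
  · have : Nonempty (PLift (i = j)) := ⟨⟨h⟩⟩
    exact Nat.card_unique
  · have : IsEmpty (PLift (i = j)) := ⟨fun x => h x.down⟩
    exact Nat.card_of_isEmpty

theorem stmt_19 (n : ℕ) [Quiver.{1} (Fin n)]
    [∀ i j : Fin n, Fintype (i ⟶ j)]
    -- no loops
    (hloops : ∀ i : Fin n, IsEmpty (i ⟶ i))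
    -- no oriented cycles
    (hacyclic : ∀ (i : Fin n) (q : Quiver.Path i i), q.length = 0)
    -- `p i j` = number of directed paths from `i` to `j`
    (p : Fin n → Fin n → ℕ)
    (hp : ∀ i j : Fin n, p i j = Nat.card (Quiver.Path i j))
    -- the Coxeter matrix `C` and its inverse `D`
    (C D : Matrix (Fin n) (Fin n) ℤ)
    (hCD : C * D = 1) (hDC : D * C = 1)
    (hC : ∀ j : Fin n, C.mulVec (fun k => (p k j : ℤ)) = fun k => -(p j k : ℤ)) :
    (∀ i j : Fin n,
      D i j = -(p i j : ℤ) + ∑ a : Σ k : Fin n, (j ⟶ k), (p i a.1 : ℤ)) ∧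
    (∀ i j : Fin n,
      C i j = -(p j i : ℤ) + ∑ b : Σ k : Fin n, (k ⟶ j), (p b.1 i : ℤ)) := by
  let P : Matrix (Fin n) (Fin n) ℤ := .of fun i j => (p i j : ℤ)
  let N : Matrix (Fin n) (Fin n) ℤ := .of fun i j => (Fintype.card (i ⟶ j) : ℤ)
  have hPN : P * (1 - N) = 1 := by
    ext i j
    have h := card_path_eq_of_acyclic hacyclic i j
    simp only [← hp] at h
    simp [P, N, mul_sub, Matrix.mul_apply, Matrix.one_apply, h]
  have hNP : (1 - N) * P = 1 := mul_eq_one_comm.mp hPN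
  have hCP : C * P = -P.transpose := by
    ext i j
    exact congrFun (hC j) i
  have hCeq : C = -P.transpose * (1 - N) := by
    rw [← hCP, mul_assoc, hPN, mul_one]
  have hDeq : D = -P * (1 - N).transpose := by
    have h : D * P.transpose = -P := by
      rw [← neg_neg P.transpose, ← hCP, mul_neg, ← mul_assoc, hDC, one_mul]
    rw [← h, mul_assoc, ← Matrix.transpose_mul, hNP, Matrix.transpose_one, mul_one]
  constructor <;> intro i j
  · rw [hDeq]
    simp [P, N, mul_sub, Matrix.mul_apply, Matrix.one_apply, Fintype.sum_sigma, mul_comm,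
      neg_add_eq_sub, Finset.sum_add_distrib]
  · rw [hCeq]
    simp [P, N, mul_sub, Matrix.mul_apply, Matrix.one_apply, Fintype.sum_sigma, mul_comm,
      neg_add_eq_sub, Finset.sum_add_distrib]
end
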